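/- Let K be a field of characteristic zero and let g_1, ..., g_n ∈ K[x_1, ..., x_n] with d := deg g_1 > 0 and D := max_{2 ≤ i ≤ n} deg g_i > 0. Let f_min be the minimal polynomial of the elimination ideal I_g ∩ K[x_1^{(∞)}], and let ν be a positive integer with ord f_min ≤ ν. Then for every monomial x_1^{e_0}(x_1')^{e_1}⋯(x_1^{(ν)})^{e_ν} appearing with nonzero coefficient in f_min: (1) if d ≤ D, then e_0 + Σ_{k=1}^{ν} (d + (k−1)(D−1)) e_k ≤ Π_{k=1}^{ν} (d + (k−1)(D−1)); and (2) if d > D, then for every integer ℓ with 0 ≤ ℓ < ν, Σ_{k=0}^{ℓ} (k(D−1)+1) e_k + Σ_{i=1}^{ν−ℓ} (i(d−1) + ℓ(D−1) + 1) e_{i+ℓ} ≤ Π_{k=1}^{ℓ} (d + (k−1)(D−1)) · Π_{i=1}^{ν−ℓ} (i(d−1) + ℓ(D−1) + 1). -/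

import Mathlib

open MvPolynomial

noncomputable section

/-- The canonical derivation on the ring of differential polynomials
`K[x_i^{(j)} : 1 ≤ i ≤ n, j ≥ 0]`, sending `x_i^{(j)}` to `x_i^{(j+1)}`. -/
def diffDer (K : Type*) [CommRing K] (n : ℕ) :
    Derivation K (MvPolynomial (Fin n × ℕ) K) (MvPolynomial (Fin n × ℕ) K) :=
  MvPolynomial.mkDerivation K fun v => X (v.1, v.2 + 1)

/-- The differential ideal generated by a set `S`: the ideal generated by all
derivatives of elements of `S`. -/
def diffIdeal (K : Type*) [CommRing K] (n : ℕ) (S : Set (MvPolynomial (Fin n × ℕ) K)) :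
    Ideal (MvPolynomial (Fin n × ℕ) K) :=
  Ideal.span {q | ∃ f ∈ S, ∃ j : ℕ, q = (⇑(diffDer K n))^[j] f}

/-- The differential ideal `I_g = ⟨x_1' - g_1, …, x_n' - g_n⟩^(∞)` of the
system `x' = g(x)`. -/
def sysIdeal (K : Type*) [CommRing K] (n : ℕ) (g : Fin n → MvPolynomial (Fin n) K) :
    Ideal (MvPolynomial (Fin n × ℕ) K) :=
  diffIdeal K n (Set.range fun i => X (i, 1) - rename (fun j => (j, 0)) (g i))

/-- The order of a differential polynomial: the largest `j` such that some variable
`x_i^{(j)}` appears. -/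
def ordOf {K : Type*} [CommSemiring K] {n : ℕ} (f : MvPolynomial (Fin n × ℕ) K) : ℕ :=
  f.vars.sup Prod.snd

/-- `f` is a minimal polynomial of the elimination ideal `I ∩ K[x_1^{(∞)}]`:
a nonzero element of `I` involving only the variables `x_1^{(j)}`, of minimal order and
then minimal total degree among all such elements. -/
def IsMinPoly (K : Type*) [Field K] (n : ℕ) [NeZero n]
    (I : Ideal (MvPolynomial (Fin n × ℕ) K)) (f : MvPolynomial (Fin n × ℕ) K) : Prop :=
  f ≠ 0 ∧ f ∈ I ∧ (∀ v ∈ f.vars, v.1 = (0 : Fin n)) ∧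
    ∀ h : MvPolynomial (Fin n × ℕ) K, h ≠ 0 → h ∈ I → (∀ v ∈ h.vars, v.1 = (0 : Fin n)) →
      ordOf f ≤ ordOf h ∧ (ordOf h ≤ ordOf f → f.totalDegree ≤ h.totalDegree)

theorem tsum_prod_pow_fin (n : ℕ) (r : Fin n → ENNReal) :
    ∑' c : Fin n → ℕ, ∏ s, r s ^ c s = ∏ s, (1 - r s)⁻¹ := by
  induction n with
  | zero => simp
  | succ n ih =>
    rw [← (Fin.consEquiv fun _ : Fin (n + 1) => ℕ).tsum_eq, ENNReal.tsum_prod']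
    simp [Fin.consEquiv, Fin.prod_univ_succ, ENNReal.tsum_mul_left, ENNReal.tsum_mul_right, ih]

/-- The multivariate geometric series. -/
theorem tsum_prod_pow {σ : Type*} [Fintype σ] (r : σ → ENNReal) :
    ∑' c : σ → ℕ, ∏ s, r s ^ c s = ∏ s, (1 - r s)⁻¹ := by
  let e := Fintype.equivFin σ
  rw [← (Equiv.arrowCongr e.symm (Equiv.refl ℕ)).tsum_eq,
    ← Equiv.prod_comp e.symm fun s => (1 - r s)⁻¹, ← tsum_prod_pow_fin]
  refine tsum_congr fun c => ?_
  rw [← Equiv.prod_comp e.symm]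
  simp

theorem ENNReal.pow_eq_tsum_ite {r : ENNReal} (hr : r < 1) (k : ℕ) :
    r ^ k = ∑' N, if k ≤ N then (1 - r) * r ^ N else 0 := by
  have h1 : (1 - r) ≠ 0 := (tsub_pos_of_lt hr).ne'
  have h2 : (1 - r) ≠ ⊤ := ENNReal.sub_ne_top ENNReal.one_ne_top
  have h3 := Summable.sum_add_tsum_nat_add' (k := k) ENNReal.summable
    (f := fun N => if k ≤ N then (1 - r) * r ^ N else 0)
  rw [← h3, Finset.sum_eq_zero fun i hi => if_neg (by simpa using hi), zero_add]
  have h4 : ∀ N, (if k ≤ N + k then (1 - r) * r ^ (N + k) else 0) = (1 - r) * r ^ N * r ^ k :=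
    fun N => by rw [if_pos (Nat.le_add_left k N), pow_add, mul_assoc]
  rw [tsum_congr h4, ENNReal.tsum_mul_right, ENNReal.tsum_mul_left, ENNReal.tsum_geometric,
    ENNReal.mul_inv_cancel h1 h2, one_mul]

theorem ENNReal.tsum_pow_eq_tsum_encard {B : Type*} (U : B → ℕ) {r : ENNReal} (hr : r < 1) :
    ∑' b, r ^ U b = ∑' N, (({b | U b ≤ N}.encard : ENat) : ENNReal) * ((1 - r) * r ^ N) := by
  simp_rw [ENNReal.pow_eq_tsum_ite hr (U _)]
  rw [ENNReal.tsum_comm]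
  refine tsum_congr fun N => ?_
  rw [← ENNReal.tsum_set_const, tsum_subtype {b | U b ≤ N} fun _ => (1 - r) * r ^ N]
  simp [Set.indicator_apply]

/-- Comparing the cardinalities of sublevel sets compares the generating functions. -/
theorem ENNReal.tsum_pow_le_of_encard_le {A C : Type*} (W : A → ℕ) (V : C → ℕ)
    (h : ∀ N, {a | W a ≤ N}.encard ≤ {c | V c ≤ N}.encard) {r : ENNReal} (hr : r < 1) :
    ∑' a, r ^ W a ≤ ∑' c, r ^ V c := by
  rw [ENNReal.tsum_pow_eq_tsum_encard W hr, ENNReal.tsum_pow_eq_tsum_encard V hr]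
  exact ENNReal.tsum_le_tsum fun N => by gcongr; exact h N

theorem geom_sum_mul_prod_le {τ σ : Type*} [Fintype τ] [Fintype σ] (a : τ → ℕ)
    (w : σ → ℕ) (M : ℕ) (hcard : Fintype.card τ + 1 ≤ Fintype.card σ)
    (ha : ∀ t, 0 < a t) (hw : ∀ s, 0 < w s)
    (h : ∀ r : ENNReal, r < 1 →
      (1 - r ^ M) * ∏ s, (1 - r ^ w s)⁻¹ ≤ ∏ t, (1 - r ^ a t)⁻¹) :
    ∀ x ∈ Set.Ioo (0 : ℝ) 1,
      (∑ i ∈ Finset.range M, x ^ i) * ∏ t, ∑ i ∈ Finset.range (a t), x ^ i ≤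
        ∏ s, ∑ i ∈ Finset.range (w s), x ^ i := by
  intro x ⟨hx0, hx1⟩
  have hpos : ∀ k : ℕ, 0 < k → 0 < 1 - x ^ k := fun k hk =>
    sub_pos.2 (pow_lt_one₀ hx0.le hx1 hk.ne')
  have hsub : ∀ k : ℕ, 1 - ENNReal.ofReal x ^ k = ENNReal.ofReal (1 - x ^ k) := fun k => by
    rw [ENNReal.ofReal_sub _ (by positivity), ENNReal.ofReal_pow hx0.le, ENNReal.ofReal_one]
  have h1 := h (ENNReal.ofReal x) (by simpa using hx1)
  simp only [hsub] at h1
  simp only [← ENNReal.ofReal_inv_of_pos (hpos _ (ha _)),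
    ← ENNReal.ofReal_inv_of_pos (hpos _ (hw _))] at h1
  have hM : 0 ≤ 1 - x ^ M := sub_nonneg.2 (pow_le_one₀ hx0.le hx1.le)
  rw [← ENNReal.ofReal_prod_of_nonneg (fun i _ => (inv_pos.2 (hpos _ (ha i))).le),
    ← ENNReal.ofReal_prod_of_nonneg (fun i _ => (inv_pos.2 (hpos _ (hw i))).le),
    ← ENNReal.ofReal_mul hM,
    ENNReal.ofReal_le_ofReal_iff (Finset.prod_nonneg fun i _ => (inv_pos.2 (hpos _ (ha i))).le),
    Finset.prod_inv_distrib, Finset.prod_inv_distrib, ← div_eq_mul_inv,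
    div_le_iff₀ (Finset.prod_pos fun i _ => hpos _ (hw i)), inv_mul_eq_div,
    le_div_iff₀ (Finset.prod_pos fun i _ => hpos _ (ha i))] at h1
  have hgeom : ∀ k : ℕ, 1 - x ^ k = (∑ i ∈ Finset.range k, x ^ i) * (1 - x) := fun k =>
    (geom_sum_mul_neg x k).symm
  rw [hgeom M, Finset.prod_congr rfl fun t _ => hgeom (a t),
    Finset.prod_congr rfl fun s _ => hgeom (w s), Finset.prod_mul_distrib,
    Finset.prod_mul_distrib, Finset.prod_const, Finset.prod_const, Finset.card_univ,
    Finset.card_univ] at h1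
  have hx : 0 < 1 - x := sub_pos.2 hx1
  obtain ⟨e, he⟩ := Nat.exists_eq_add_of_le hcard
  rw [he] at h1
  have hW : 0 ≤ ∏ s, ∑ i ∈ Finset.range (w s), x ^ i :=
    Finset.prod_nonneg fun s _ => Finset.sum_nonneg fun i _ => by positivity
  have he1 : (1 - x) ^ e ≤ 1 := pow_le_one₀ hx.le (by linarith)
  have hpow : 0 < (1 - x) ^ (Fintype.card τ + 1) := by positivity
  revert h1 hW hpow
  generalize ∏ s, ∑ i ∈ Finset.range (w s), x ^ i = Q
  generalize ∏ t, ∑ i ∈ Finset.range (a t), x ^ i = P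
  generalize ∑ i ∈ Finset.range M, x ^ i = G
  intro h1 hW hpow
  refine le_of_mul_le_mul_right ?_ hpow
  have h2 : Q * (1 - x) ^ (Fintype.card τ + 1) * (1 - x) ^ e ≤
      Q * (1 - x) ^ (Fintype.card τ + 1) := mul_le_of_le_one_right (by positivity) he1
  rw [mul_assoc] at h2
  rw [pow_add _ _ e] at h1
  refine le_trans (le_of_eq ?_) (h1.trans h2)
  rw [pow_succ]
  ring

theorem mul_prod_le_prod_of_geom_le {τ σ : Type*} [Fintype τ] [Fintype σ] (a : τ → ℕ)
    (w : σ → ℕ) (M : ℕ) (hcard : Fintype.card τ + 1 ≤ Fintype.card σ)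
    (ha : ∀ t, 0 < a t) (hw : ∀ s, 0 < w s)
    (h : ∀ r : ENNReal, r < 1 →
      (1 - r ^ M) * ∏ s, (1 - r ^ w s)⁻¹ ≤ ∏ t, (1 - r ^ a t)⁻¹) :
    M * ∏ t, a t ≤ ∏ s, w s := by
  have key := geom_sum_mul_prod_le a w M hcard ha hw h
  have hmem : (1 : ℝ) ∈ closure (Set.Ioo (0 : ℝ) 1) := by
    rw [closure_Ioo zero_ne_one]
    exact Set.right_mem_Icc.2 zero_le_one
  have hlim := ContinuousWithinAt.closure_le hmem
    (Continuous.continuousWithinAt (by fun_prop)) (Continuous.continuousWithinAt (by fun_prop)) key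
  simp only [one_pow, Finset.sum_const, Finset.card_range, nsmul_eq_mul, mul_one] at hlim
  exact_mod_cast hlim

/-- The span of the monomials of weight at most `N` in a family of elements of an algebra. -/
def weightSpan (K : Type*) {T σ : Type*} [Field K] [CommRing T] [Algebra K T] [Fintype σ]
    (w : σ → ℕ) (z : σ → T) (N : ℕ) : Submodule K T :=
  Submodule.span K {x | ∃ c : σ → ℕ, ∑ s, w s * c s ≤ N ∧ ∏ s, z s ^ c s = x}

namespace weightSpan

variable {K T σ σ' : Type*} [Field K] [CommRing T] [Algebra K T] [Fintype σ] [Fintype σ']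
  {w : σ → ℕ} {z : σ → T}

theorem mono {M N : ℕ} (h : M ≤ N) : weightSpan K w z M ≤ weightSpan K w z N :=
  Submodule.span_mono fun _ ⟨c, hc, hx⟩ => ⟨c, hc.trans h, hx⟩

theorem one_mem (N : ℕ) : (1 : T) ∈ weightSpan K w z N :=
  Submodule.subset_span ⟨0, by simp, by simp⟩

theorem self_mem (s : σ) : z s ∈ weightSpan K w z (w s) := by
  classical
  exact Submodule.subset_span ⟨Pi.single s 1, by simp [Pi.single_apply], by
    simp [Pi.single_apply, pow_ite]⟩

theorem mul_mem {x y : T} {M N : ℕ} (hx : x ∈ weightSpan K w z M)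
    (hy : y ∈ weightSpan K w z N) : x * y ∈ weightSpan K w z (M + N) := by
  have h : weightSpan K w z M * weightSpan K w z N ≤ weightSpan K w z (M + N) := by
    rw [weightSpan, weightSpan, Submodule.span_mul_span]
    refine Submodule.span_mono ?_
    rintro _ ⟨_, ⟨c, hc, rfl⟩, _, ⟨e, he, rfl⟩, rfl⟩
    refine ⟨c + e, ?_, ?_⟩
    · simpa [mul_add, Finset.sum_add_distrib] using add_le_add hc he
    · simp [pow_add, Finset.prod_mul_distrib]
  exact h (Submodule.mul_mem_mul hx hy)

theorem pow_mem {x : T} {M : ℕ} (hx : x ∈ weightSpan K w z M) (e : ℕ) :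
    x ^ e ∈ weightSpan K w z (M * e) := by
  induction e with
  | zero => simpa using one_mem 0
  | succ e ih => rw [pow_succ, mul_add_one]; exact mul_mem ih hx

theorem prod_mem {ι : Type*} (S : Finset ι) (x : ι → T) (M : ι → ℕ)
    (h : ∀ i ∈ S, x i ∈ weightSpan K w z (M i)) :
    ∏ i ∈ S, x i ∈ weightSpan K w z (∑ i ∈ S, M i) := by
  classical
  induction S using Finset.induction_on with
  | empty => simpa using one_mem 0
  | insert i S hi ih =>
    rw [Finset.prod_insert hi, Finset.sum_insert hi]
    exact mul_mem (h i (by simp)) (ih fun j hj => h j (by simp [hj]))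

theorem aeval_mem {τ : Type*} {x : τ → T} (hx : ∀ i, x i ∈ weightSpan K w z 1)
    (g : MvPolynomial τ K) : aeval x g ∈ weightSpan K w z g.totalDegree := by
  rw [aeval_def, eval₂_eq]
  refine Submodule.sum_mem _ fun m hm => ?_
  rw [← Algebra.smul_def]
  refine Submodule.smul_mem _ _ (mono (le_totalDegree hm) (prod_mem _ _ _ fun i _ => ?_))
  simpa using pow_mem (hx i) (m i)

theorem derivation_mem (δ : ℕ) (Δ : Derivation K T T) {w : σ → ℕ} {z : σ → T} {w' : σ' → ℕ}
    {z' : σ' → T} (hz : ∀ s, z s ∈ weightSpan K w' z' (w s))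
    (hΔ : ∀ s, Δ (z s) ∈ weightSpan K w' z' (w s + δ)) {N : ℕ} {x : T}
    (hx : x ∈ weightSpan K w z N) : Δ x ∈ weightSpan K w' z' (N + δ) := by
  have hmul : ∀ {x y : T} {M N : ℕ},
      x ∈ weightSpan K w' z' M ∧ Δ x ∈ weightSpan K w' z' (M + δ) →
      y ∈ weightSpan K w' z' N ∧ Δ y ∈ weightSpan K w' z' (N + δ) →
      x * y ∈ weightSpan K w' z' (M + N) ∧ Δ (x * y) ∈ weightSpan K w' z' (M + N + δ) := by
    rintro x y M N ⟨hx, hx'⟩ ⟨hy, hy'⟩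
    refine ⟨mul_mem hx hy, ?_⟩
    rw [Derivation.leibniz, smul_eq_mul, smul_eq_mul]
    refine Submodule.add_mem _ ?_ ?_
    · rw [add_assoc]; exact mul_mem hx hy'
    · rw [show M + N + δ = N + (M + δ) by ring]; exact mul_mem hy hx'
  have hpow : ∀ s e, z s ^ e ∈ weightSpan K w' z' (w s * e) ∧
      Δ (z s ^ e) ∈ weightSpan K w' z' (w s * e + δ) := by
    intro s e
    induction e with
    | zero => simp [one_mem]
    | succ e ih => rw [pow_succ, mul_add_one]; exact hmul ih ⟨hz s, hΔ s⟩
  have hprod : ∀ (c : σ → ℕ) (S : Finset σ),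
      ∏ s ∈ S, z s ^ c s ∈ weightSpan K w' z' (∑ s ∈ S, w s * c s) ∧
      Δ (∏ s ∈ S, z s ^ c s) ∈ weightSpan K w' z' (∑ s ∈ S, w s * c s + δ) := by
    classical
    intro c S
    induction S using Finset.induction_on with
    | empty => simp [one_mem]
    | insert i S hi ih =>
      rw [Finset.prod_insert hi, Finset.sum_insert hi]
      exact hmul (hpow i _) ih
  induction hx using Submodule.span_induction with
  | mem x hx =>
    obtain ⟨c, hc, rfl⟩ := hx
    exact mono (by gcongr) (hprod c Finset.univ).2
  | zero => simp
  | add x y _ _ hx hy => rw [map_add]; exact Submodule.add_mem _ hx hy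
  | smul a x _ hx => rw [Δ.map_smul]; exact Submodule.smul_mem _ _ hx

theorem encard_le_of_linearIndependent {A : Type*} {v : A → T} (hv : LinearIndependent K v)
    {W : A → ℕ} (hW : ∀ a, v a ∈ weightSpan K w z (W a)) (N : ℕ) :
    {a | W a ≤ N}.encard ≤ {c : σ → ℕ | ∑ s, w s * c s ≤ N}.encard := by
  set C := {c : σ → ℕ | ∑ s, w s * c s ≤ N}
  by_cases hfin : C.Finite
  · have hfin' := hfin.image fun c => ∏ s, z s ^ c s
    have heq : weightSpan K w z N = Submodule.span K ((fun c => ∏ s, z s ^ c s) '' C) := rfl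
    have hmem : ∀ a : {a | W a ≤ N}, v a ∈ Submodule.span K ((fun c => ∏ s, z s ^ c s) '' C) :=
      fun a => heq ▸ mono a.2 (hW a)
    have h := hv.comp ((↑) : {a | W a ≤ N} → A) Subtype.val_injective
    have := hfin'.to_subtype
    have := hfin'.fintype
    have := FiniteDimensional.span_of_finite K hfin'
    have h2 : LinearIndependent K fun a : {a | W a ≤ N} =>
        (⟨v a, hmem a⟩ : Submodule.span K ((fun c => ∏ s, z s ^ c s) '' C)) :=
      LinearIndependent.of_comp (Submodule.subtype _) h
    have := h2.finite
    have := Fintype.ofFinite {a | W a ≤ N}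
    have h3 := h2.fintype_card_le_finrank
    have h4 := finrank_span_le_card (R := K) ((fun c => ∏ s, z s ^ c s) '' C)
    rw [← Set.ncard_eq_toFinset_card'] at h4
    have h5 := Set.ncard_image_le (f := fun c => ∏ s, z s ^ c s) hfin
    rw [← Nat.card_eq_fintype_card, Nat.card_coe_set_eq] at h3
    rw [← (Set.toFinite {a | W a ≤ N}).cast_ncard_eq, ← hfin.cast_ncard_eq]
    exact_mod_cast (h3.trans h4).trans h5
  · rw [Set.encard_eq_top hfin]
    exact le_top

end weightSpan

/-- A polynomial has a monomial of maximal weight dividing some monomial of each of its nonzero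
multiples. -/
theorem exists_leading_monomial {K σ : Type*} [Field K] [Fintype σ] (w : σ → ℕ)
    {f : MvPolynomial σ K} (hf : f ≠ 0) :
    ∃ L : σ →₀ ℕ, (∀ m ∈ f.support, ∑ s, w s * m s ≤ ∑ s, w s * L s) ∧
      ∀ h : MvPolynomial σ K, h ≠ 0 → ∃ e ∈ (f * h).support, L ≤ e := by
  let _ : LinearOrder σ := LinearOrder.lift' (Fintype.equivFin σ) (Fintype.equivFin σ).injective
  let key : (σ →₀ ℕ) → ℕ ×ₗ Lex (σ →₀ ℕ) := fun m => toLex (∑ s, w s * m s, toLex m)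
  have hadd : ∀ m m', key (m + m') = key m + key m' := fun m m' => by
    simp [key, mul_add, Finset.sum_add_distrib, ← toLex_add]
  have hinj : Function.Injective key := fun m m' h => by
    simpa [key] using congrArg (fun x => (ofLex x).2) h
  obtain ⟨L, hL, hLmax⟩ := f.support.exists_max_image key (support_nonempty.2 hf)
  refine ⟨L, fun m hm => ?_, fun h hh => ?_⟩
  · have := hLmax m hm
    rw [Prod.Lex.toLex_le_toLex] at this
    rcases this with h | h
    · exact h.le
    · exact h.1.le
  · obtain ⟨e, he, hemax⟩ := h.support.exists_max_image key (support_nonempty.2 hh)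
    refine ⟨L + e, ?_, le_self_add⟩
    classical
    rw [mem_support_iff, coeff_mul, Finset.sum_eq_single (L, e)]
    · exact mul_ne_zero (mem_support_iff.1 hL) (mem_support_iff.1 he)
    · rintro ⟨a, b⟩ hab hne
      by_contra hne0
      have ha := hLmax a (mem_support_iff.2 (left_ne_zero_of_mul hne0))
      have hb := hemax b (mem_support_iff.2 (right_ne_zero_of_mul hne0))
      rw [Finset.HasAntidiagonal.mem_antidiagonal] at hab
      have hk : key a + key b = key L + key e := by rw [← hadd, ← hadd]; exact congrArg key hab
      have ha' := hinj ((add_eq_add_iff_eq_and_eq ha hb).1 hk).1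
      have hb' := hinj ((add_eq_add_iff_eq_and_eq ha hb).1 hk).2
      exact hne (by simp [ha', hb'])
    · simp

/-- The monomials not divisible by `L` and their generating function. -/
theorem tsum_not_le {σ : Type*} [Fintype σ] (w : σ → ℕ) (hw : ∀ s, 0 < w s) (L : σ →₀ ℕ)
    {r : ENNReal} (hr : r < 1) :
    ∑' c : {c : σ →₀ ℕ // ¬ L ≤ c}, r ^ ∑ s, w s * c.1 s =
      (1 - r ^ ∑ s, w s * L s) * ∏ s, (1 - r ^ w s)⁻¹ := by
  have hZ : ∑' c : σ →₀ ℕ, r ^ ∑ s, w s * c s = ∏ s, (1 - r ^ w s)⁻¹ := by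
    rw [← tsum_prod_pow, ← Finsupp.equivFunOnFinite.tsum_eq]
    simp [Finset.prod_pow_eq_pow_sum, ← pow_mul]
  have hle : ∑' c : {c : σ →₀ ℕ // L ≤ c}, r ^ ∑ s, w s * c.1 s =
      r ^ (∑ s, w s * L s) * ∏ s, (1 - r ^ w s)⁻¹ := by
    let e : (σ →₀ ℕ) ≃ {c : σ →₀ ℕ // L ≤ c} :=
      { toFun := fun c => ⟨L + c, le_self_add⟩
        invFun := fun c => c.1 - L
        left_inv := fun c => by simp
        right_inv := fun c => Subtype.ext (add_tsub_cancel_of_le c.2) }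
    rw [← hZ, ← e.tsum_eq, ← ENNReal.tsum_mul_left]
    refine tsum_congr fun c => ?_
    simp [e, mul_add, Finset.sum_add_distrib, pow_add]
  have hadd := ENNReal.summable.tsum_add_tsum_compl (s := {c : σ →₀ ℕ | L ≤ c})
    (f := fun c => r ^ ∑ s, w s * c s) ENNReal.summable
  have hfin : ∏ s, (1 - r ^ w s)⁻¹ ≠ ⊤ := ENNReal.prod_ne_top fun s _ =>
    ENNReal.inv_ne_top.2 (tsub_pos_of_lt (pow_lt_one₀ zero_le hr (hw s).ne')).ne'
  have hr1 : r ^ (∑ s, w s * L s) ≤ 1 := pow_le_one₀ zero_le hr.le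
  rw [hZ] at hadd
  change (∑' c : {c : σ →₀ ℕ // L ≤ c}, r ^ ∑ s, w s * c.1 s) +
    (∑' c : {c : σ →₀ ℕ // ¬ L ≤ c}, r ^ ∑ s, w s * c.1 s) = _ at hadd
  rw [hle] at hadd
  rw [ENNReal.sub_mul fun _ _ => hfin, one_mul]
  refine ENNReal.eq_sub_of_add_eq ?_ (by rw [add_comm]; exact hadd)
  exact ENNReal.mul_ne_top (ne_top_of_le_ne_top ENNReal.one_ne_top hr1) hfin

/-- Monomials in the variables indexed by `κ` are linearly independent over elements whose
values at `0` are. -/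
theorem linearIndependent_monomial_mul {K κ τ A : Type*} [Field K]
    {h : A → MvPolynomial (κ ⊕ τ) K}
    (hh : LinearIndependent K fun a =>
      aeval (Sum.elim (fun _ => (0 : MvPolynomial τ K)) X) (h a)) :
    LinearIndependent K fun p : (κ →₀ ℕ) × A =>
      (p.1.prod fun k e => (X (Sum.inl k) : MvPolynomial (κ ⊕ τ) K) ^ e) * h p.2 := by
  classical
  let E : MvPolynomial (κ ⊕ τ) K →ₐ[K] MvPolynomial κ (MvPolynomial τ K) :=
    aeval (Sum.elim X fun i => C (X i))
  have hE : ∀ q, aeval (Sum.elim (fun _ => (0 : MvPolynomial τ K)) X) q =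
      constantCoeff (E q) := by
    intro q
    induction q using MvPolynomial.induction_on with
    | C a =>
      simp [E, MvPolynomial.algebraMap_eq, IsScalarTower.algebraMap_apply K (MvPolynomial τ K)
        (MvPolynomial κ (MvPolynomial τ K))]
    | add p q hp hq => simp only [map_add, hp, hq]
    | mul_X p i hp =>
      rw [map_mul, map_mul, map_mul, hp]
      rcases i with i | i <;> simp [E]
  refine LinearIndependent.of_comp E.toLinearMap ?_
  have hmon : ∀ p : (κ →₀ ℕ) × A, E ((p.1.prod fun k e => X (Sum.inl k) ^ e) * h p.2) =
      monomial p.1 1 * E (h p.2) := by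
    intro p
    rw [map_mul, monomial_eq, C_1, one_mul, Finsupp.prod, map_prod]
    simp [E, Finsupp.prod]
  rw [linearIndependent_iff]
  intro l hl
  by_contra hne
  obtain ⟨p0, hp0, hmin⟩ :=
    l.support.exists_minimalFor Prod.fst (Finsupp.support_nonempty_iff.2 hne)
  have hcoef := congrArg (coeff p0.1) hl
  rw [Finsupp.linearCombination_apply, Finsupp.sum, coeff_sum, coeff_zero] at hcoef
  have hterm : ∀ p ∈ l.support,
      coeff p0.1 (l p • (E.toLinearMap ∘ fun p : (κ →₀ ℕ) × A =>
        (p.1.prod fun k e => (X (Sum.inl k) : MvPolynomial (κ ⊕ τ) K) ^ e) * h p.2) p) =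
      if p.1 = p0.1 then
        l p • aeval (Sum.elim (fun _ => (0 : MvPolynomial τ K)) X) (h p.2) else 0 := by
    intro p hp
    rw [Function.comp_apply, AlgHom.toLinearMap_apply, hmon, coeff_smul, coeff_monomial_mul', hE]
    by_cases hle : p.1 ≤ p0.1
    · have heq : p.1 = p0.1 := le_antisymm hle (hmin hp hle)
      simp [heq, constantCoeff_eq]
    · rw [if_neg hle, if_neg fun heq => hle heq.le, smul_zero]
  rw [Finset.sum_congr rfl hterm, ← Finset.sum_filter] at hcoef
  rw [linearIndependent_iff'] at hh
  have hinj : Set.InjOn Prod.snd (l.support.filter fun p => p.1 = p0.1 : Set ((κ →₀ ℕ) × A)) := by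
    intro p hp q hq hpq
    simp only [Finset.coe_filter, Set.mem_ofPred_eq] at hp hq
    exact Prod.ext (hp.2.trans hq.2.symm) hpq
  have hsum : ∑ a ∈ (l.support.filter fun p => p.1 = p0.1).image Prod.snd,
      l (p0.1, a) • aeval (Sum.elim (fun _ => (0 : MvPolynomial τ K)) X) (h a) = 0 := by
    refine (Finset.sum_image hinj).trans (Eq.trans ?_ hcoef)
    refine Finset.sum_congr rfl fun p hp => ?_
    rw [← (Finset.mem_filter.1 hp).2]
  have := hh _ _ hsum p0.2 (Finset.mem_image_of_mem _ (by simpa using hp0))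
  exact Finsupp.mem_support_iff.1 hp0 this

/-- The monomials not divisible by a leading monomial of a generator of the relation ideal are
linearly independent. -/
theorem linearIndependent_not_le {K σ T : Type*} [Field K] [Fintype σ] [CommRing T] [Algebra K T]
    {p : σ → T} {f : MvPolynomial σ K} (hdiv : ∀ G, aeval p G = 0 → f ∣ G) {L : σ →₀ ℕ}
    (hL : ∀ h : MvPolynomial σ K, h ≠ 0 → ∃ e ∈ (f * h).support, L ≤ e) :
    LinearIndependent K fun c : {c : σ →₀ ℕ // ¬ L ≤ c} => ∏ s, p s ^ c.1 s := by
  have hmon : (fun c : {c : σ →₀ ℕ // ¬ L ≤ c} => ∏ s, p s ^ c.1 s) =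
      (aeval p : MvPolynomial σ K →ₐ[K] T).toLinearMap ∘ fun c => monomial c.1 (1 : K) := by
    funext c
    simp [aeval_monomial, Finsupp.prod_fintype]
  have hbasis : LinearIndependent K fun c : {c : σ →₀ ℕ // ¬ L ≤ c} => monomial c.1 (1 : K) := by
    simpa [Function.comp_def] using (basisMonomials σ K).linearIndependent.comp
      ((↑) : {c : σ →₀ ℕ // ¬ L ≤ c} → _) Subtype.val_injective
  rw [hmon]
  refine hbasis.map ?_
  rw [Submodule.disjoint_def]
  intro G hG hker
  obtain ⟨h, rfl⟩ := hdiv G hker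
  by_contra hne
  obtain ⟨e, he, hle⟩ := hL h (right_ne_zero_of_mul hne)
  have hG' : f * h ∈ restrictSupport K {c : σ →₀ ℕ | ¬ L ≤ c} := by
    refine Submodule.span_le.2 ?_ hG
    rintro _ ⟨c, rfl⟩
    exact (monomial_mem_restrictSupport K).2 (Or.inl c.2)
  exact (mem_restrictSupport_iff K).1 hG' he hle

theorem linearIndependent_prod_pow {B T ι : Type*} [CommRing B] [CommRing T] [Algebra B T]
    [Fintype ι] {x : ι → T} (hx : AlgebraicIndependent B x) :
    LinearIndependent B fun b : ι →₀ ℕ => ∏ i, x i ^ b i := by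
  have hmon : (fun b : ι →₀ ℕ => ∏ i, x i ^ b i) =
      (aeval x : MvPolynomial ι B →ₐ[B] T).toLinearMap ∘ basisMonomials ι B := by
    funext c
    simp [aeval_monomial, Finsupp.prod_fintype]
  rw [hmon]
  exact (basisMonomials ι B).linearIndependent.map' _ (LinearMap.ker_eq_bot.2 hx)

theorem ENNReal.tsum_prod_mul {α β : Type*} (u : α → ENNReal) (v : β → ENNReal) :
    ∑' q : α × β, u q.1 * v q.2 = (∑' a, u a) * ∑' b, v b := by
  rw [ENNReal.tsum_prod (f := fun a b => u a * v b)]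
  simp_rw [ENNReal.tsum_mul_left]
  rw [ENNReal.tsum_mul_right]

theorem tsum_pow_weight {σ : Type*} [Fintype σ] (w : σ → ℕ) (r : ENNReal) :
    ∑' c : σ → ℕ, r ^ ∑ s, w s * c s = ∏ s, (1 - r ^ w s)⁻¹ := by
  rw [← tsum_prod_pow]
  simp [Finset.prod_pow_eq_pow_sum, ← pow_mul]

theorem tsum_pow_weight_finsupp {σ : Type*} [Fintype σ] (w : σ → ℕ) (r : ENNReal) :
    ∑' c : σ →₀ ℕ, r ^ ∑ s, w s * c s = ∏ s, (1 - r ^ w s)⁻¹ := by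
  rw [← tsum_pow_weight, ← Finsupp.equivFunOnFinite.tsum_eq]
  simp

theorem weight_mul_prod_le {K σ ι κ τ ρ : Type*} [Field K] [Fintype σ] [Fintype ι] [Fintype κ]
    [Fintype ρ] {y : σ → MvPolynomial (κ ⊕ τ) K}
    {f : MvPolynomial σ K} (hf : f ≠ 0) {p : σ → MvPolynomial τ K}
    (hp : ∀ s, aeval (Sum.elim (fun _ => (0 : MvPolynomial τ K)) X) (y s) = p s)
    (hdiv : ∀ G, aeval p G = 0 → f ∣ G) (J : ι → τ)
    (hJ : AlgebraicIndependent (Algebra.adjoin K (Set.range p))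
      fun i => (X (J i) : MvPolynomial τ K))
    (a : ρ → ℕ) (z : ρ → MvPolynomial (κ ⊕ τ) K) (w : σ → ℕ) (D : κ → ℕ)
    (ha : ∀ t, 0 < a t) (hw : ∀ s, 0 < w s) (hD : ∀ k, 0 < D k)
    (hy : ∀ s, y s ∈ weightSpan K a z (w s))
    (hl : ∀ k, (X (Sum.inl k) : MvPolynomial (κ ⊕ τ) K) ∈ weightSpan K a z (D k))
    (hr : ∀ i, (X (Sum.inr i) : MvPolynomial (κ ⊕ τ) K) ∈ weightSpan K a z 1)
    (hcard : Fintype.card ρ + 1 ≤ Fintype.card σ + Fintype.card ι + Fintype.card κ)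
    {m : σ →₀ ℕ} (hm : m ∈ f.support) :
    (∑ s, w s * m s) * ∏ t, a t ≤ (∏ s, w s) * ∏ k, D k := by
  obtain ⟨L, hLmax, hL⟩ := exists_leading_monomial w hf
  refine (Nat.mul_le_mul_right _ (hLmax m hm)).trans ?_
  have hlin1 := linearIndependent_not_le hdiv hL
  have hlin2 := linearIndependent_prod_pow hJ
  have hlin3 : LinearIndependent K fun c : {c : σ →₀ ℕ // ¬ L ≤ c} =>
      (⟨∏ s, p s ^ c.1 s, Subalgebra.prod_mem _ fun s _ =>
        Subalgebra.pow_mem _ (Algebra.subset_adjoin (Set.mem_range_self s)) _⟩ :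
          Algebra.adjoin K (Set.range p)) :=
    LinearIndependent.of_comp (Algebra.adjoin K (Set.range p)).val.toLinearMap hlin1
  have hlin4 := linearIndependent_smul hlin3 hlin2
  have hlin := linearIndependent_monomial_mul (K := K) (κ := κ) (τ := τ)
    (h := fun q : {c : σ →₀ ℕ // ¬ L ≤ c} × (ι →₀ ℕ) =>
      (∏ s, y s ^ q.1.1 s) * ∏ i, X (Sum.inr (J i)) ^ q.2 i) (by
        have heq : ∀ q : {c : σ →₀ ℕ // ¬ L ≤ c} × (ι →₀ ℕ),
            aeval (Sum.elim (fun _ => (0 : MvPolynomial τ K)) X)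
              ((∏ s, y s ^ q.1.1 s) * ∏ i, X (Sum.inr (J i)) ^ q.2 i) =
            (∏ s, p s ^ q.1.1 s) * ∏ i, X (J i) ^ q.2 i := fun q => by
          rw [map_mul, map_prod, map_prod]
          simp_rw [map_pow, hp, aeval_X, Sum.elim_inr]
        simp_rw [heq]
        exact hlin4)
  have hcount := weightSpan.encard_le_of_linearIndependent (w := a) (z := z) hlin
    (W := fun q => ∑ k, D k * q.1 k + (∑ s, w s * q.2.1.1 s + ∑ i, q.2.2 i)) (by
      intro q
      refine weightSpan.mul_mem ?_ (weightSpan.mul_mem ?_ ?_)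
      · rw [Finsupp.prod_fintype _ _ fun _ => pow_zero _]
        exact weightSpan.prod_mem _ _ _ fun k _ => weightSpan.pow_mem (hl k) _
      · exact weightSpan.prod_mem _ _ _ fun s _ => weightSpan.pow_mem (hy s) _
      · exact weightSpan.prod_mem _ _ _ fun i _ => by
          simpa using weightSpan.pow_mem (hr (J i)) (q.2.2 i))
  have hres := mul_prod_le_prod_of_geom_le a (Sum.elim w (Sum.elim (fun _ : ι => 1) D))
    (∑ s, w s * L s) (by simpa [add_assoc] using hcard) ha
    (by rintro (s | i | k) <;> simp [hw, hD]) (fun r hr => by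
      have h := ENNReal.tsum_pow_le_of_encard_le _ _ hcount hr
      rw [tsum_pow_weight] at h
      refine le_trans (le_of_eq ?_) h
      have h1 := tsum_pow_weight_finsupp (fun _ : ι => 1) r
      simp only [one_mul] at h1
      have h2 := ENNReal.tsum_prod_mul
        (fun c : {c : σ →₀ ℕ // ¬ L ≤ c} => r ^ ∑ s, w s * c.1 s)
        (fun b : ι →₀ ℕ => r ^ ∑ i, b i)
      have h3 := ENNReal.tsum_prod_mul (fun c : κ →₀ ℕ => r ^ ∑ k, D k * c k)
        (fun q : {c : σ →₀ ℕ // ¬ L ≤ c} × (ι →₀ ℕ) =>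
          r ^ (∑ s, w s * q.1.1 s) * r ^ ∑ i, q.2 i)
      rw [h2, tsum_not_le w hw L hr, tsum_pow_weight_finsupp, h1] at h3
      simp_rw [pow_add]
      rw [h3]
      simp only [Fintype.prod_sum_type, Sum.elim_inl, Sum.elim_inr]
      ring)
  simpa [Fintype.prod_sum_type] using hres

theorem trdeg_adjoin_range_lt {K T : Type*} {σ : Type} [Field K] [Fintype σ] [CommRing T]
    [IsDomain T] [Algebra K T] (p : σ → T) {f : MvPolynomial σ K} (hf : f ≠ 0)
    (hpf : aeval p f = 0) :
    Algebra.trdeg K (Algebra.adjoin K (Set.range p)) < Fintype.card σ := by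
  set B := Algebra.adjoin K (Set.range p) with hB
  let p' : σ → B := fun s => ⟨p s, Algebra.subset_adjoin (Set.mem_range_self s)⟩
  have htop : Algebra.adjoin K (Set.range p') = ⊤ := by
    rw [← Algebra.adjoin_adjoin_coe_preimage (R := K) (s := Set.range p)]
    congr 1
    ext x
    simp [p', Subtype.ext_iff]
  have hp'f : aeval p' f = 0 := by
    refine Subtype.val_injective ?_
    change B.val (aeval p' f) = 0
    rw [← AlgHom.comp_apply, comp_aeval]
    exact hpf
  by_contra! hle
  have halg : Algebra.IsAlgebraic (Algebra.adjoin K (Set.range p')) B := by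
    rw [htop]
    exact ⟨fun x => isAlgebraic_algebraMap (⟨x, trivial⟩ : (⊤ : Subalgebra K B))⟩
  have hind := (Algebra.IsAlgebraic.isTranscendenceBasis_of_lift_le_trdeg_of_finite K p'
    (by simpa using hle)).1
  exact hf (hind.eq_zero_of_aeval_eq_zero f hp'f)

theorem exists_isTranscendenceBasis_X {K B : Type*} {τ : Type} [Field K] [Finite τ]
    [CommRing B] [Algebra K B] [Algebra B (MvPolynomial τ K)]
    [IsScalarTower K B (MvPolynomial τ K)] [FaithfulSMul B (MvPolynomial τ K)] :
    ∃ J : Set τ, IsTranscendenceBasis B (fun i : J => (X (i : τ) : MvPolynomial τ K)) := by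
  have htop : Algebra.adjoin B (Set.range (X : τ → MvPolynomial τ K)) = ⊤ := by
    refine eq_top_iff.2 fun x _ => ?_
    have hx : x ∈ Algebra.adjoin K (Set.range (X : τ → MvPolynomial τ K)) := by
      rw [adjoin_range_X]; trivial
    have hle : Algebra.adjoin K (Set.range (X : τ → MvPolynomial τ K)) ≤
        (Algebra.adjoin B (Set.range (X : τ → MvPolynomial τ K))).restrictScalars K :=
      Algebra.adjoin_le Algebra.subset_adjoin
    exact hle hx
  have halg : Algebra.IsAlgebraic
      (Algebra.adjoin B (Set.range (X : τ → MvPolynomial τ K))) (MvPolynomial τ K) := by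
    rw [htop]
    exact ⟨fun x => isAlgebraic_algebraMap
      (⟨x, trivial⟩ : (⊤ : Subalgebra B (MvPolynomial τ K)))⟩
  obtain ⟨t, hts, ht⟩ := exists_isTranscendenceBasis_subset (R := B)
    (Set.range (X : τ → MvPolynomial τ K))
  let e : X ⁻¹' t ≃ t := Equiv.ofBijective (fun i => ⟨X i.1, i.2⟩)
    ⟨fun i j hij => Subtype.ext (X_injective (congrArg Subtype.val hij)), fun ⟨x, hx⟩ => by
      obtain ⟨i, rfl⟩ := hts hx
      exact ⟨⟨i, hx⟩, rfl⟩⟩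
  exact ⟨X ⁻¹' t, ht.comp_equiv e⟩

/-- An algebraically dependent family of polynomials can be completed by more than
`card τ - card σ` variables that are independent over it. -/
theorem exists_algebraicIndependent_X_of_relation {K : Type*} {σ τ : Type} [Field K] [Fintype σ]
    [Fintype τ] (p : σ → MvPolynomial τ K) {f : MvPolynomial σ K} (hf : f ≠ 0)
    (hpf : aeval p f = 0) :
    ∃ J : Set τ, AlgebraicIndependent (Algebra.adjoin K (Set.range p))
      (fun i : J => (X (i : τ) : MvPolynomial τ K)) ∧
      Fintype.card τ + 1 ≤ Fintype.card σ + Nat.card J := by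
  obtain ⟨J, hJ⟩ := exists_isTranscendenceBasis_X (K := K) (τ := τ)
    (B := Algebra.adjoin K (Set.range p))
  refine ⟨J, hJ.1, ?_⟩
  have hlt := trdeg_adjoin_range_lt p hf hpf
  have hadd := trdeg_add_eq K (Algebra.adjoin K (Set.range p)) (A := MvPolynomial τ K)
  have hcard := hJ.lift_cardinalMk_eq_trdeg
  rw [MvPolynomial.trdeg_of_isDomain] at hadd
  obtain ⟨b, hb⟩ := Cardinal.lt_aleph0.1 (hlt.trans (Cardinal.natCast_lt_aleph0))
  rw [← Nat.cast_card (α := J), Cardinal.lift_natCast, Cardinal.lift_id'] at hcard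
  rw [hb, ← hcard, Cardinal.mk_fintype, Cardinal.lift_natCast] at hadd
  rw [hb] at hlt
  norm_cast at hlt hadd
  omega

theorem Polynomial.dvd_of_irreducible_of_eval₂_eq_zero {A L : Type*} (F : Type*) [CommRing A]
    [IsDomain A] [UniqueFactorizationMonoid A] [Field F] [Algebra A F] [IsFractionRing A F]
    [Field L]
    {φ : A →+* L} (hφ : Function.Injective φ) {t : L} {P Q : Polynomial A} (hP : Irreducible P)
    (hPt : P.eval₂ φ t = 0) (hQt : Q.eval₂ φ t = 0) : P ∣ Q := by
  have hdeg : P.natDegree ≠ 0 := fun h => by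
    rw [Polynomial.natDegree_eq_zero] at h
    obtain ⟨c, rfl⟩ := h
    rw [Polynomial.eval₂_C, map_eq_zero_iff _ hφ] at hPt
    exact hP.ne_zero (by rw [hPt, Polynomial.C_0])
  have hprim := hP.isPrimitive hdeg
  have hPF := (hprim.irreducible_iff_irreducible_map_fraction_map (K := F)).1 hP
  refine hprim.dvd_of_fraction_map_dvd_fraction_map (K := F) ?_
  by_contra hndvd
  let ψ : F →+* L := IsFractionRing.lift hφ
  have hψ : ψ.comp (algebraMap A F) = φ :=
    RingHom.ext fun a => IsFractionRing.lift_algebraMap hφ a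
  rw [← hψ, ← Polynomial.eval₂_map] at hPt hQt
  obtain ⟨u, v, huv⟩ := (hPF.coprime_iff_not_dvd).2 hndvd
  have := congrArg (Polynomial.eval₂ ψ t) huv
  rw [Polynomial.eval₂_add, Polynomial.eval₂_mul, Polynomial.eval₂_mul, hPt, hQt,
    Polynomial.eval₂_one, mul_zero, mul_zero, add_zero] at this
  exact zero_ne_one this

/-- A relation of minimal degree is irreducible. -/
theorem irreducible_of_totalDegree_minimal {K σ T : Type*} [Field K] [CommRing T] [IsDomain T]
    [Algebra K T] {p : σ → T} {f : MvPolynomial σ K} (hf : f ≠ 0) (hpf : aeval p f = 0)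
    (hmin : ∀ h : MvPolynomial σ K, h ≠ 0 → aeval p h = 0 → f.totalDegree ≤ h.totalDegree) :
    Irreducible f := by
  have hunit : ∀ a b : MvPolynomial σ K, f = a * b → aeval p a = 0 → IsUnit b :=
      fun a b hab ha => by
    have hab0 : a ≠ 0 ∧ b ≠ 0 := mul_ne_zero_iff.1 (hab ▸ hf)
    have hdeg := totalDegree_mul_of_isDomain hab0.1 hab0.2
    have := hmin a hab0.1 ha
    rw [← hab] at hdeg
    have hb := totalDegree_eq_zero_iff_eq_C.1 (by omega : b.totalDegree = 0)
    rw [hb] at hab0 ⊢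
    exact (isUnit_iff_ne_zero.2 fun h => hab0.2 (by rw [h, C_0])).map C
  refine ⟨fun hu => ?_, fun a b hab => ?_⟩
  · exact (hu.map (aeval p)).ne_zero hpf
  · rw [hab, map_mul] at hpf
    rcases mul_eq_zero.1 hpf with h | h
    · exact Or.inr (hunit a b hab h)
    · exact Or.inl (hunit b a (by rw [hab, mul_comm]) h)

/-- An irreducible relation divides all relations, when all but one of the elements are
algebraically independent. -/
theorem dvd_of_irreducible_of_aeval_eq_zero {K σ L : Type*} [Field K] [Field L] [Algebra K L]
    {p : Option σ → L} (hp : AlgebraicIndependent K (p ∘ some)) {f : MvPolynomial (Option σ) K}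
    (hf : Irreducible f) (hpf : aeval p f = 0)
    {G : MvPolynomial (Option σ) K} (hG : aeval p G = 0) : f ∣ G := by
  let e := optionEquivLeft K σ
  let φ : MvPolynomial σ K →+* L := (aeval (p ∘ some) : MvPolynomial σ K →ₐ[K] L).toRingHom
  have heval : ∀ q, Polynomial.eval₂ φ (p none) (e q) = aeval p q := fun q => by
    induction q using MvPolynomial.induction_on with
    | C a => simp [e, φ]
    | add a b ha hb => rw [map_add, Polynomial.eval₂_add, ha, hb, map_add]
    | mul_X a i ha =>
      rw [map_mul, Polynomial.eval₂_mul, ha, map_mul]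
      cases i <;> simp [e, φ]
  have hdvd := Polynomial.dvd_of_irreducible_of_eval₂_eq_zero
    (FractionRing (MvPolynomial σ K)) (φ := φ) hp (t := p none)
    ((MulEquiv.irreducible_iff e).2 hf)
    (by rw [heval, hpf]) (by rw [heval, hG])
  exact (map_dvd_iff e).1 hdvd

theorem dvd_of_aeval_eq_zero_of_minimal {K σ T L : Type*} [Field K] [CommRing T] [IsDomain T]
    [Algebra K T] [Field L] [Algebra K L] {j : T →ₐ[K] L} (hj : Function.Injective j)
    {p : Option σ → T} (hp : AlgebraicIndependent K (p ∘ some))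
    {f : MvPolynomial (Option σ) K} (hf : f ≠ 0) (hpf : aeval p f = 0)
    (hmin : ∀ h : MvPolynomial (Option σ) K, h ≠ 0 → aeval p h = 0 →
      f.totalDegree ≤ h.totalDegree)
    {G : MvPolynomial (Option σ) K} (hG : aeval p G = 0) : f ∣ G := by
  have hmap : ∀ q : MvPolynomial (Option σ) K, aeval p q = 0 → aeval (j ∘ p) q = 0 :=
    fun q hq => by
      have := congrArg j hq
      rwa [map_zero, ← AlgHom.comp_apply, comp_aeval] at this
  have hirr : Irreducible f := irreducible_of_totalDegree_minimal hf hpf hmin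
  have hp' : AlgebraicIndependent K ((j ∘ p) ∘ some) := hp.map' hj
  have h1 := hmap f hpf
  have h2 := hmap G hG
  exact dvd_of_irreducible_of_aeval_eq_zero (L := L) (p := j ∘ p) hp' hirr h1 h2

theorem MvPolynomial.totalDegree_le_rename {R σ τ : Type*} [CommSemiring R] {e : σ → τ}
    (he : Function.Injective e) (p : MvPolynomial σ R) :
    p.totalDegree ≤ (rename e p).totalDegree := by
  refine Finset.sup_le fun m hm => ?_
  have hm' : m.mapDomain e ∈ (rename e p).support := by
    rwa [mem_support_iff, coeff_rename_mapDomain e he, ← mem_support_iff]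
  have := le_totalDegree hm'
  rwa [Finsupp.sum_mapDomain_index (fun _ => rfl) fun _ _ _ => rfl] at this

section sysIdeal

variable {K : Type*} [Field K] {n : ℕ} (g : Fin n → MvPolynomial (Fin n) K)

/-- The derivation of the polynomial ring along the vector field `g`. -/
def lieDer : Derivation K (MvPolynomial (Fin n) K) (MvPolynomial (Fin n) K) :=
  mkDerivation K g

/-- The evaluation of differential polynomials on the solution of `x' = g(x)`. -/
def sysEval : MvPolynomial (Fin n × ℕ) K →ₐ[K] MvPolynomial (Fin n) K :=
  aeval fun v => (lieDer g)^[v.2] (X v.1)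

theorem sysEval_diffDer (f : MvPolynomial (Fin n × ℕ) K) :
    sysEval g (diffDer K n f) = lieDer g (sysEval g f) := by
  induction f using MvPolynomial.induction_on with
  | C a => simp [sysEval, ← MvPolynomial.algebraMap_eq]
  | add a b ha hb => simp only [map_add, ha, hb]
  | mul_X a v ha =>
    rw [Derivation.leibniz, map_add, smul_eq_mul, smul_eq_mul, map_mul, map_mul, ha, map_mul,
      Derivation.leibniz, smul_eq_mul, smul_eq_mul]
    simp [diffDer, sysEval, mkDerivation_X, Function.iterate_succ_apply']

theorem sysEval_rename (q : MvPolynomial (Fin n) K) :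
    sysEval g (rename (fun j => (j, 0)) q) = q := by
  rw [sysEval, aeval_rename]
  simp [Function.comp_def]

theorem diffDer_mem_diffIdeal {S : Set (MvPolynomial (Fin n × ℕ) K)}
    {f : MvPolynomial (Fin n × ℕ) K} (hf : f ∈ diffIdeal K n S) :
    diffDer K n f ∈ diffIdeal K n S := by
  induction hf using Submodule.span_induction with
  | mem x hx =>
    obtain ⟨q, hq, j, rfl⟩ := hx
    exact Ideal.subset_span ⟨q, hq, j + 1, (Function.iterate_succ_apply' _ _ _).symm⟩
  | zero => simp
  | add x y _ _ hx hy => rw [map_add]; exact Ideal.add_mem _ hx hy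
  | smul a x hx' hx =>
    rw [smul_eq_mul, Derivation.leibniz, smul_eq_mul, smul_eq_mul]
    exact Ideal.add_mem _ (Ideal.mul_mem_left _ _ hx) (Ideal.mul_mem_right _ _ hx')

theorem diffDer_rename_sub_mem (q : MvPolynomial (Fin n) K) :
    diffDer K n (rename (fun j => (j, 0)) q) - rename (fun j => (j, 0)) (lieDer g q) ∈
      sysIdeal K n g := by
  induction q using MvPolynomial.induction_on with
  | C a => simp [lieDer, diffDer]
  | add a b ha hb =>
    simp only [map_add]
    rw [add_sub_add_comm]
    exact Ideal.add_mem _ ha hb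
  | mul_X a i ha =>
    have hX : diffDer K n (X (i, 0)) - rename (fun j => (j, 0)) (g i) ∈ sysIdeal K n g :=
      Ideal.subset_span ⟨_, ⟨i, rfl⟩, 0, by simp [diffDer, mkDerivation_X]⟩
    have hL : lieDer g (X i) = g i := mkDerivation_X _ _ _
    rw [map_mul, rename_X, Derivation.leibniz, Derivation.leibniz, hL]
    simp only [smul_eq_mul, map_add, map_mul, rename_X]
    have h := Ideal.add_mem _ (Ideal.mul_mem_left _ (rename (fun j => (j, 0)) a) hX)
      (Ideal.mul_mem_left _ (X (i, 0)) ha)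
    convert h using 1
    ring

theorem X_sub_rename_mem (i : Fin n) (j : ℕ) :
    X (i, j) - rename (fun j => (j, 0)) ((lieDer g)^[j] (X i)) ∈ sysIdeal K n g := by
  induction j with
  | zero => simp
  | succ j ih =>
    have ih' : diffDer K n _ ∈ sysIdeal K n g := diffDer_mem_diffIdeal ih
    have h := Ideal.add_mem _ ih' (diffDer_rename_sub_mem g ((lieDer g)^[j] (X i)))
    rw [Function.iterate_succ_apply']
    simpa [diffDer, mkDerivation_X] using h

theorem sub_rename_sysEval_mem (f : MvPolynomial (Fin n × ℕ) K) :
    f - rename (fun j => (j, 0)) (sysEval g f) ∈ sysIdeal K n g := by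
  rw [← Ideal.Quotient.eq, ← Ideal.Quotient.mkₐ_eq_mk K]
  change _ = ((Ideal.Quotient.mkₐ K (sysIdeal K n g)).comp
    ((rename fun j => (j, 0)).comp (sysEval g))) f
  congr 1
  refine MvPolynomial.algHom_ext fun v => ?_
  have := X_sub_rename_mem g v.1 v.2
  rw [← Ideal.Quotient.eq, ← Ideal.Quotient.mkₐ_eq_mk K] at this
  simpa [sysEval] using this

/-- The ideal of the system is the kernel of the evaluation along its solution. -/
theorem mem_sysIdeal_iff {f : MvPolynomial (Fin n × ℕ) K} :
    f ∈ sysIdeal K n g ↔ sysEval g f = 0 := by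
  refine ⟨fun hf => ?_, fun hf => by simpa [hf] using sub_rename_sysEval_mem g f⟩
  have hiter : ∀ j q, sysEval g ((diffDer K n)^[j] q) = (lieDer g)^[j] (sysEval g q) := by
    intro j
    induction j with
    | zero => simp
    | succ j ih => intro q; rw [Function.iterate_succ_apply, Function.iterate_succ_apply, ih,
        sysEval_diffDer]
  refine Submodule.span_induction (fun q hq => ?_) (map_zero _) (fun a b _ _ ha hb => ?_)
    (fun a b _ hb => ?_) hf
  · obtain ⟨_, ⟨i, rfl⟩, j, rfl⟩ := hq
    rw [hiter, map_sub, sysEval_rename]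
    simp [sysEval, lieDer, mkDerivation_X, iterate_map_zero]
  · rw [map_add, ha, hb, add_zero]
  · rw [smul_eq_mul, map_mul, hb, mul_zero]

/-- The variable orders of a differential polynomial of order `N` in one variable. -/
def orderIdx (N : ℕ) (s : Option (Fin N)) : ℕ := s.elim N (↑)

theorem orderIdx_injective (N : ℕ) : Function.Injective (orderIdx N) := by
  rintro (_ | a) (_ | b) h
  · rfl
  · exact absurd h b.2.ne'
  · exact absurd h a.2.ne
  · exact congrArg some (Fin.ext h)

theorem orderIdx_le (N : ℕ) (s : Option (Fin N)) : orderIdx N s ≤ N := by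
  rcases s with _ | a
  · exact le_rfl
  · exact a.2.le

theorem sysEval_rename_zero [NeZero n] {σ : Type*} (e : σ → ℕ) (q : MvPolynomial σ K) :
    sysEval g (rename (fun s => ((0 : Fin n), e s)) q) =
      aeval (fun s => (lieDer g)^[e s] (X 0)) q := by
  rw [sysEval, aeval_rename]
  rfl

theorem mem_vars_rename_zero [NeZero n] {σ : Type*} {e : σ → ℕ} {q : MvPolynomial σ K}
    {v : Fin n × ℕ} (hv : v ∈ (rename (fun s => ((0 : Fin n), e s)) q).vars) :
    v.1 = 0 ∧ ∃ s, e s = v.2 := by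
  classical
  obtain ⟨s, _, rfl⟩ := Finset.mem_image.1 (vars_rename _ _ hv)
  exact ⟨rfl, s, rfl⟩

/-- The minimal polynomial of the system generates the relations between the derivatives of the
first coordinate up to its order. -/
theorem exists_rename_eq_of_isMinPoly [NeZero n] {f : MvPolynomial (Fin n × ℕ) K}
    (hf : IsMinPoly K n (sysIdeal K n g) f) :
    ∃ f' : MvPolynomial (Option (Fin (ordOf f))) K,
      f = rename (fun s => ((0 : Fin n), orderIdx (ordOf f) s)) f' ∧ f' ≠ 0 ∧
      aeval (fun s => (lieDer g)^[orderIdx (ordOf f) s] (X 0)) f' = 0 ∧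
      ∀ G : MvPolynomial (Option (Fin (ordOf f))) K,
        aeval (fun s => (lieDer g)^[orderIdx (ordOf f) s] (X 0)) G = 0 → f' ∣ G := by
  obtain ⟨hf0, hfI, hfv, hmin⟩ := hf
  set N := ordOf f with hN
  have hinj : ∀ {σ : Type} {e : σ → ℕ}, Function.Injective e →
      Function.Injective fun s => ((0 : Fin n), e s) := fun he a b h => he (Prod.ext_iff.1 h).2
  obtain ⟨f', hf'⟩ := exists_rename_eq_of_vars_subset_range f
    (fun s => ((0 : Fin n), orderIdx N s)) (hinj (orderIdx_injective N)) (by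
      intro v hv
      have hle : v.2 ≤ N := Finset.le_sup (f := Prod.snd) hv
      rcases hle.eq_or_lt with h | h
      · exact ⟨none, Prod.ext (hfv v hv).symm h.symm⟩
      · exact ⟨some ⟨v.2, h⟩, Prod.ext (hfv v hv).symm rfl⟩)
  have hf'0 : f' ≠ 0 := by
    rintro rfl
    exact hf0 (by rw [← hf', map_zero])
  have heval : aeval (fun s => (lieDer g)^[orderIdx N s] (X 0)) f' = 0 := by
    rw [← sysEval_rename_zero, hf']
    exact (mem_sysIdeal_iff g).1 hfI
  refine ⟨f', hf'.symm, hf'0, heval, fun G hG => ?_⟩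
  refine dvd_of_aeval_eq_zero_of_minimal (T := MvPolynomial (Fin n) K)
    (L := FractionRing (MvPolynomial (Fin n) K)) (j := IsScalarTower.toAlgHom K _ _)
    (IsFractionRing.injective _ _) ?_ hf'0 heval (fun h hh0 hh => ?_) hG
  · rw [algebraicIndependent_iff]
    intro q hq
    by_contra hq0
    have hren := (hmin (rename (fun k : Fin N => ((0 : Fin n), (k : ℕ))) q)
      (by rwa [Ne, map_eq_zero_iff _ (rename_injective _ (hinj Fin.val_injective))])
      ((mem_sysIdeal_iff g).2 ((sysEval_rename_zero g _ q).trans hq))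
      fun v hv => (mem_vars_rename_zero hv).1).1
    rcases Nat.eq_zero_or_pos N with h0 | h0
    · have : IsEmpty (Fin N) := by rw [h0]; infer_instance
      exact hq0 (algebraicIndependent_iff.1 (algebraicIndependent_empty_type (K := K)) q hq)
    · refine absurd hren (not_le.2 ((Finset.sup_lt_iff h0).2 fun v hv => ?_))
      obtain ⟨_, k, hk⟩ := mem_vars_rename_zero hv
      exact hk ▸ k.2
  · have := (hmin (rename (fun s => ((0 : Fin n), orderIdx N s)) h)
      (by rwa [Ne, map_eq_zero_iff _ (rename_injective _ (hinj (orderIdx_injective N)))])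
      ((mem_sysIdeal_iff g).2 ((sysEval_rename_zero g _ h).trans hh))
      fun v hv => (mem_vars_rename_zero hv).1).2 (Finset.sup_le fun v hv => by
        obtain ⟨_, s, hs⟩ := mem_vars_rename_zero hv
        exact hs ▸ orderIdx_le N s)
    rw [← hf'] at this
    exact (totalDegree_le_rename (hinj (orderIdx_injective N)) f').trans
      (this.trans (totalDegree_rename_le _ _))

end sysIdeal

theorem weightSpan.le_of_mem {K T σ σ' : Type*} [Field K] [CommRing T] [Algebra K T] [Fintype σ]
    [Fintype σ'] {w : σ → ℕ} {z : σ → T} {w' : σ' → ℕ} {z' : σ' → T}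
    (hz : ∀ s, z s ∈ weightSpan K w' z' (w s)) (N : ℕ) :
    weightSpan K w z N ≤ weightSpan K w' z' N := by
  refine Submodule.span_le.2 ?_
  rintro _ ⟨c, hc, rfl⟩
  refine weightSpan.mono hc (weightSpan.prod_mem _ _ (fun s => w s * c s) fun s _ => ?_)
  exact weightSpan.pow_mem (hz s) (c s)

section lift

variable {K : Type*} [Field K] {n : ℕ} (ℓ : ℕ)

/-- The `k`-th perturbation variable, which vanishes from index `ℓ` on. -/
def liftVar (k : ℕ) : MvPolynomial (Fin ℓ ⊕ Fin n) K :=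
  if h : k < ℓ then X (Sum.inl ⟨k, h⟩) else 0

theorem liftVar_of_lt {k : ℕ} (h : k < ℓ) :
    liftVar (K := K) (n := n) ℓ k = X (Sum.inl ⟨k, h⟩) := dif_pos h

theorem liftVar_of_le {k : ℕ} (h : ℓ ≤ k) : liftVar (K := K) (n := n) ℓ k = 0 :=
  dif_neg h.not_gt

theorem aeval_liftVar (k : ℕ) :
    aeval (Sum.elim (fun _ => (0 : MvPolynomial (Fin n) K)) X) (liftVar (K := K) (n := n) ℓ k)
      = 0 := by
  rw [liftVar]
  split_ifs
  · rw [aeval_X, Sum.elim_inl]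
  · rw [map_zero]

variable [NeZero n] (g : Fin n → MvPolynomial (Fin n) K)

/-- The derivation of the perturbed system, in which `g 0` is replaced by `g 0` plus the first
perturbation variable. -/
def liftDer : Derivation K (MvPolynomial (Fin ℓ ⊕ Fin n) K) (MvPolynomial (Fin ℓ ⊕ Fin n) K) :=
  mkDerivation K (Sum.elim (fun k : Fin ℓ => liftVar ℓ (k + 1 : ℕ))
    fun i => rename Sum.inr (g i) + if i = 0 then liftVar ℓ 0 else 0)

/-- The `k`-th derivative of the first coordinate in the perturbed system. -/
def liftIter (k : ℕ) : MvPolynomial (Fin ℓ ⊕ Fin n) K := (liftDer ℓ g)^[k] (X (Sum.inr 0))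

/-- The derivatives of the first coordinate of orders `1, …, j`, together with all coordinates. -/
def liftFam (j : ℕ) : Fin ℓ ⊕ Fin n → MvPolynomial (Fin ℓ ⊕ Fin n) K :=
  Sum.elim (fun k => if (k : ℕ) < j then liftIter ℓ g (k + 1) else 0) fun i => X (Sum.inr i)

/-- The weights of `liftFam`. -/
def liftWeight (n ℓ e : ℕ) : Fin ℓ ⊕ Fin n → ℕ := Sum.elim (fun k => (k + 1) * e + 1) fun _ => 1

theorem liftDer_X_inl (k : Fin ℓ) : liftDer ℓ g (X (Sum.inl k)) = liftVar ℓ (k + 1 : ℕ) := by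
  rw [liftDer, mkDerivation_X, Sum.elim_inl]

theorem liftDer_X_inr (i : Fin n) : liftDer ℓ g (X (Sum.inr i)) =
    rename Sum.inr (g i) + if i = 0 then liftVar ℓ 0 else 0 := by
  rw [liftDer, mkDerivation_X, Sum.elim_inr]

theorem liftDer_liftVar (k : ℕ) : liftDer ℓ g (liftVar ℓ k) = liftVar ℓ (k + 1) := by
  rcases lt_or_ge k ℓ with h | h
  · rw [liftVar_of_lt ℓ h, liftDer_X_inl]
  · rw [liftVar_of_le ℓ h, map_zero, liftVar_of_le ℓ (by omega)]

theorem liftIter_succ' (k : ℕ) : liftIter ℓ g (k + 1) = liftDer ℓ g (liftIter ℓ g k) :=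
  Function.iterate_succ_apply' _ _ _

theorem liftIter_succ (k : ℕ) : liftIter ℓ g (k + 1) =
    (liftDer ℓ g)^[k] (rename Sum.inr (g 0)) + liftVar ℓ k := by
  induction k with
  | zero => simp [liftIter, liftDer_X_inr]
  | succ k ih =>
    rw [liftIter_succ', ih, map_add, liftDer_liftVar, Function.iterate_succ_apply']

theorem aeval_liftDer (q : MvPolynomial (Fin ℓ ⊕ Fin n) K) :
    aeval (Sum.elim (fun _ => (0 : MvPolynomial (Fin n) K)) X) (liftDer ℓ g q) =
      lieDer g (aeval (Sum.elim (fun _ => 0) X) q) := by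
  induction q using MvPolynomial.induction_on with
  | C a => simp
  | add p q hp hq => simp only [map_add, hp, hq]
  | mul_X p s hp =>
    rw [Derivation.leibniz, map_mul, Derivation.leibniz]
    simp only [smul_eq_mul, map_add, map_mul, hp]
    congr 2
    rcases s with k | i
    · rw [liftDer_X_inl, aeval_liftVar, aeval_X, Sum.elim_inl, map_zero]
    · rw [liftDer_X_inr, aeval_X, Sum.elim_inr, lieDer, mkDerivation_X, map_add, aeval_rename,
        Sum.elim_comp_inr, aeval_X_left_apply]
      split_ifs
      · rw [aeval_liftVar, add_zero]
      · rw [map_zero, add_zero]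

theorem aeval_liftIter (k : ℕ) :
    aeval (Sum.elim (fun _ => (0 : MvPolynomial (Fin n) K)) X) (liftIter ℓ g k) =
      (lieDer g)^[k] (X 0) := by
  induction k with
  | zero => simp [liftIter]
  | succ k ih => rw [liftIter_succ', aeval_liftDer, ih, Function.iterate_succ_apply']

theorem liftFam_inl (j : ℕ) (k : Fin ℓ) :
    liftFam ℓ g j (Sum.inl k) = if (k : ℕ) < j then liftIter ℓ g (k + 1) else 0 := rfl

theorem liftFam_inr (j : ℕ) (i : Fin n) : liftFam ℓ g j (Sum.inr i) = X (Sum.inr i) := rfl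

variable {g} {d e : ℕ}

theorem rename_inr_mem {j : ℕ} (q : MvPolynomial (Fin n) K) :
    rename Sum.inr q ∈ weightSpan K (liftWeight n ℓ e) (liftFam ℓ g j) q.totalDegree := by
  rw [rename_eq_aeval]
  exact weightSpan.aeval_mem (fun i => weightSpan.self_mem (z := liftFam ℓ g j)
    (w := liftWeight n ℓ e) (Sum.inr i)) q

theorem liftIter_mem_liftFam {j k : ℕ} (hk : k < j) (hj : j ≤ ℓ) :
    liftIter ℓ g (k + 1) ∈ weightSpan K (liftWeight n ℓ e) (liftFam ℓ g j) ((k + 1) * e + 1) := by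
  have := weightSpan.self_mem (K := K) (z := liftFam ℓ g j) (w := liftWeight n ℓ e)
    (Sum.inl ⟨k, hk.trans_le hj⟩)
  simpa [liftFam, liftWeight, hk] using this

theorem liftFam_mem_liftFam {j j' : ℕ} (hj : j ≤ j') (hj' : j' ≤ ℓ) (s : Fin ℓ ⊕ Fin n) :
    liftFam ℓ g j s ∈ weightSpan K (liftWeight n ℓ e) (liftFam ℓ g j') (liftWeight n ℓ e s) := by
  rcases s with k | i
  · rw [liftFam_inl]
    split_ifs with h
    · exact liftIter_mem_liftFam ℓ (h.trans_le hj) hj'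
    · exact Submodule.zero_mem _
  · exact weightSpan.self_mem (Sum.inr i)

theorem iterate_liftDer_mem (hd : (g 0).totalDegree ≤ d)
    (he : ∀ i ≠ 0, (g i).totalDegree ≤ e + 1) {k : ℕ} (hk : k ≤ ℓ) :
    (liftDer ℓ g)^[k] (rename Sum.inr (g 0)) ∈
      weightSpan K (liftWeight n ℓ e) (liftFam ℓ g k) (d + k * e) := by
  induction k with
  | zero =>
    rw [zero_mul, add_zero]
    exact weightSpan.mono hd (rename_inr_mem ℓ (g 0))
  | succ k ih =>
    rw [Function.iterate_succ_apply', add_one_mul, ← add_assoc]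
    refine weightSpan.derivation_mem e _ (liftFam_mem_liftFam ℓ k.le_succ hk) (fun s => ?_)
      (ih (by omega))
    rcases s with i | i
    · rw [liftFam_inl]
      split_ifs with h
      · rw [← liftIter_succ']
        refine weightSpan.mono ?_ (liftIter_mem_liftFam ℓ (Nat.succ_lt_succ h) hk)
        simp only [liftWeight, Sum.elim_inl]
        linarith
      · rw [map_zero]
        exact Submodule.zero_mem _
    · rw [liftFam_inr]
      by_cases hi : i = 0
      · subst hi
        refine weightSpan.mono ?_ (liftIter_mem_liftFam (k := 0) ℓ k.succ_pos hk)
        simp only [liftWeight, Sum.elim_inr]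
        linarith
      · rw [liftDer_X_inr, if_neg hi, add_zero]
        refine weightSpan.mono ?_ (rename_inr_mem ℓ (g i))
        simp only [liftWeight, Sum.elim_inr]
        linarith [he i hi]

theorem liftIter_mem {k : ℕ} (hk : k ≤ ℓ) :
    liftIter ℓ g k ∈ weightSpan K (liftWeight n ℓ e) (liftFam ℓ g ℓ) (k * e + 1) := by
  rcases k with _ | k
  · rw [zero_mul]
    exact weightSpan.self_mem (Sum.inr 0)
  · exact liftIter_mem_liftFam ℓ hk le_rfl

theorem liftVar_mem (hd : (g 0).totalDegree ≤ d) (he : ∀ i ≠ 0, (g i).totalDegree ≤ e + 1)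
    (hed : e < d) {k : ℕ} (hk : k < ℓ) :
    liftVar ℓ k ∈ weightSpan K (liftWeight n ℓ e) (liftFam ℓ g ℓ) (d + k * e) := by
  rw [← sub_eq_of_eq_add' (liftIter_succ ℓ g k)]
  refine Submodule.sub_mem _ (weightSpan.mono ?_ (liftIter_mem ℓ hk))
    (weightSpan.le_of_mem (liftFam_mem_liftFam ℓ hk.le le_rfl) _
      (iterate_liftDer_mem ℓ hd he hk.le))
  linarith

theorem liftIter_mem_succ (hd : (g 0).totalDegree ≤ d)
    (he : ∀ i ≠ 0, (g i).totalDegree ≤ e + 1) :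
    liftIter ℓ g (ℓ + 1) ∈ weightSpan K (liftWeight n ℓ e) (liftFam ℓ g ℓ) (d + ℓ * e) := by
  rw [liftIter_succ, liftVar_of_le ℓ le_rfl, add_zero]
  exact iterate_liftDer_mem ℓ hd he le_rfl

theorem liftDer_liftFam_mem (hd : (g 0).totalDegree ≤ d)
    (he : ∀ i ≠ 0, (g i).totalDegree ≤ e + 1) {δ : ℕ} (heδ : e ≤ δ) (hdδ : d ≤ δ + 1)
    (s : Fin ℓ ⊕ Fin n) :
    liftDer ℓ g (liftFam ℓ g ℓ s) ∈
      weightSpan K (liftWeight n ℓ e) (liftFam ℓ g ℓ) (liftWeight n ℓ e s + δ) := by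
  have key : ∀ k ≤ ℓ, liftIter ℓ g (k + 1) ∈
      weightSpan K (liftWeight n ℓ e) (liftFam ℓ g ℓ) (k * e + 1 + δ) := by
    intro k hk
    rcases hk.lt_or_eq with h | rfl
    · exact weightSpan.mono (by linarith) (liftIter_mem ℓ h)
    · exact weightSpan.mono (by linarith) (liftIter_mem_succ _ hd he)
  rcases s with i | i
  · rw [liftFam_inl, if_pos i.2, ← liftIter_succ']
    exact key _ i.2
  · rw [liftFam_inr]
    by_cases hi : i = 0
    · subst hi
      have := key 0 ℓ.zero_le
      rw [zero_mul, zero_add] at this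
      exact this
    · rw [liftDer_X_inr, if_neg hi, add_zero]
      refine weightSpan.mono ?_ (rename_inr_mem ℓ (g i))
      simp only [liftWeight, Sum.elim_inr]
      linarith [he i hi]

theorem liftIter_mem_add (hd : (g 0).totalDegree ≤ d)
    (he : ∀ i ≠ 0, (g i).totalDegree ≤ e + 1) {δ : ℕ} (heδ : e ≤ δ) (hdδ : d ≤ δ + 1) (i : ℕ) :
    liftIter ℓ g (ℓ + 1 + i) ∈
      weightSpan K (liftWeight n ℓ e) (liftFam ℓ g ℓ) (d + ℓ * e + i * δ) := by
  induction i with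
  | zero => simpa using liftIter_mem_succ ℓ hd he
  | succ i ih =>
    rw [← add_assoc, liftIter_succ', add_one_mul, ← add_assoc]
    exact weightSpan.derivation_mem δ _ (fun s => weightSpan.self_mem s)
      (liftDer_liftFam_mem ℓ hd he heδ hdδ) ih

end lift

/-- The weight of the derivative of order `k`. -/
def orderWeight (d e δ ℓ k : ℕ) : ℕ :=
  if k ≤ ℓ then k * e + 1 else d + ℓ * e + (k - (ℓ + 1)) * δ

theorem liftIter_mem_orderWeight {K : Type*} [Field K] {n : ℕ} [NeZero n] (ℓ : ℕ)
    {g : Fin n → MvPolynomial (Fin n) K} {d e : ℕ} (hd : (g 0).totalDegree ≤ d)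
    (he : ∀ i ≠ 0, (g i).totalDegree ≤ e + 1) {δ : ℕ} (heδ : e ≤ δ) (hdδ : d ≤ δ + 1) (k : ℕ) :
    liftIter ℓ g k ∈
      weightSpan K (liftWeight n ℓ e) (liftFam ℓ g ℓ) (orderWeight d e δ ℓ k) := by
  rw [orderWeight]
  split_ifs with h
  · exact liftIter_mem ℓ h
  · have := liftIter_mem_add ℓ hd he heδ hdδ (k - (ℓ + 1))
    rwa [Nat.add_sub_of_le (by omega)] at this

theorem sum_orderIdx {M : Type*} [AddCommMonoid M] (N : ℕ) (F : ℕ → M) :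
    ∑ s, F (orderIdx N s) = ∑ k ∈ Finset.range (N + 1), F k := by
  rw [Fintype.sum_option, Finset.sum_range_succ, add_comm, Finset.sum_range]
  rfl

theorem prod_orderIdx {M : Type*} [CommMonoid M] (N : ℕ) (F : ℕ → M) :
    ∏ s, F (orderIdx N s) = ∏ k ∈ Finset.range (N + 1), F k := by
  rw [Fintype.prod_option, Finset.prod_range_succ, mul_comm, Finset.prod_range]
  rfl

theorem orderWeight_pos {d : ℕ} (hd : 0 < d) (e δ ℓ k : ℕ) : 0 < orderWeight d e δ ℓ k := by
  rw [orderWeight]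
  split_ifs <;> omega

/-- The weighted degree bound for a minimal polynomial, before cancelling the common factor. -/
theorem IsMinPoly.sum_orderWeight_mul_le {K : Type*} [Field K] {n : ℕ} [NeZero n]
    {g : Fin n → MvPolynomial (Fin n) K} {f : MvPolynomial (Fin n × ℕ) K}
    (hf : IsMinPoly K n (sysIdeal K n g) f) {d e δ ℓ : ℕ} (hd0 : 0 < d)
    (hd : (g 0).totalDegree ≤ d) (he : ∀ i ≠ 0, (g i).totalDegree ≤ e + 1) (heδ : e ≤ δ)
    (hdδ : d ≤ δ + 1) (hℓ : 0 < ℓ → e < d) {m : (Fin n × ℕ) →₀ ℕ} (hm : coeff m f ≠ 0) :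
    (∑ k ∈ Finset.range (ordOf f + 1), orderWeight d e δ ℓ k * m (0, k)) *
        ∏ k ∈ Finset.range ℓ, ((k + 1) * e + 1) ≤
      (∏ k ∈ Finset.range (ordOf f + 1), orderWeight d e δ ℓ k) *
        ∏ k ∈ Finset.range ℓ, (d + k * e) := by
  obtain ⟨f', hff', hf'0, hrel, hdiv⟩ := exists_rename_eq_of_isMinPoly g hf
  set N := ordOf f
  have hinj : Function.Injective fun s => ((0 : Fin n), orderIdx N s) :=
    fun a b h => orderIdx_injective N (Prod.ext_iff.1 h).2
  obtain ⟨m', rfl, hm'⟩ := coeff_rename_ne_zero _ _ _ (hff' ▸ hm)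
  obtain ⟨J, hJ, hcard⟩ := exists_algebraicIndependent_X_of_relation _ hf'0 hrel
  have := Fintype.ofFinite J
  have main := weight_mul_prod_le (ι := J) (κ := Fin ℓ) (ρ := Fin ℓ ⊕ Fin n)
    (y := fun s => liftIter ℓ g (orderIdx N s)) hf'0 (fun s => aeval_liftIter ℓ g _) hdiv
    Subtype.val hJ (liftWeight n ℓ e) (liftFam ℓ g ℓ)
    (fun s => orderWeight d e δ ℓ (orderIdx N s)) (fun k => d + k * e)
    (by rintro (k | i) <;> simp [liftWeight]) (fun s => orderWeight_pos hd0 e δ ℓ _)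
    (fun k => by omega) (fun s => liftIter_mem_orderWeight ℓ hd he heδ hdδ _)
    (fun k => by
      have := liftVar_mem ℓ hd he (hℓ (by have := k.2; omega)) k.2
      rwa [liftVar_of_lt] at this)
    (fun i => weightSpan.self_mem (Sum.inr i))
    (by
      rw [Nat.card_eq_fintype_card] at hcard
      simp only [Fintype.card_sum, Fintype.card_fin, Fintype.card_option] at hcard ⊢
      change n + 1 ≤ N + 1 + _ at hcard
      omega)
    (mem_support_iff.2 hm')
  have hsum := sum_orderIdx N fun k => orderWeight d e δ ℓ k *
    m'.mapDomain (fun s => ((0 : Fin n), orderIdx N s)) (0, k)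
  simp only [Finsupp.mapDomain_apply hinj] at hsum
  rw [← prod_orderIdx, Finset.prod_range, Finset.prod_range, ← hsum]
  simpa [liftWeight] using main

theorem prod_range_orderWeight (d e δ ℓ r : ℕ) :
    ∏ k ∈ Finset.range (ℓ + 1 + r), orderWeight d e δ ℓ k =
      (∏ k ∈ Finset.range ℓ, ((k + 1) * e + 1)) *
        ∏ i ∈ Finset.range r, (d + ℓ * e + i * δ) := by
  rw [Finset.prod_range_add, Finset.prod_range_succ']
  congr 1
  · rw [orderWeight, if_pos ℓ.zero_le, zero_mul, zero_add, mul_one]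
    refine Finset.prod_congr rfl fun k hk => ?_
    rw [orderWeight, if_pos (Nat.succ_le_of_lt (Finset.mem_range.1 hk))]
  · refine Finset.prod_congr rfl fun i _ => ?_
    rw [orderWeight, if_neg (by omega), Nat.add_sub_cancel_left]

/-- The Newton polytope bound for a minimal polynomial, relative to any upper bound `ν` of its
order. -/
theorem IsMinPoly.sum_orderWeight_mul_le_of_ordOf_le {K : Type*} [Field K] {n : ℕ} [NeZero n]
    {g : Fin n → MvPolynomial (Fin n) K} {f : MvPolynomial (Fin n × ℕ) K}
    (hf : IsMinPoly K n (sysIdeal K n g) f) {d e δ ℓ ν : ℕ} (hd0 : 0 < d)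
    (hd : (g 0).totalDegree ≤ d) (he : ∀ i ≠ 0, (g i).totalDegree ≤ e + 1) (heδ : e ≤ δ)
    (hdδ : d ≤ δ + 1) (hℓ : 0 < ℓ → e < d) {m : (Fin n × ℕ) →₀ ℕ} (hm : coeff m f ≠ 0)
    (hν : ordOf f ≤ ν) (hℓν : ℓ ≤ ν) :
    ∑ k ∈ Finset.range (ν + 1), orderWeight d e δ ℓ k * m (0, k) ≤
      (∏ k ∈ Finset.range ℓ, (d + k * e)) *
        ∏ i ∈ Finset.range (ν - ℓ), (d + ℓ * e + i * δ) := by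
  have hzero : ∀ k, ordOf f < k → m (0, k) = 0 := by
    intro k hk
    by_contra h
    have : ((0 : Fin n), k) ∈ f.vars :=
      (mem_vars_iff_mem_support _).2 ⟨m, mem_support_iff.2 hm, Finsupp.mem_support_iff.2 h⟩
    exact hk.not_ge (Finset.le_sup (f := Prod.snd) this)
  have hsum : ∑ k ∈ Finset.range (ν + 1), orderWeight d e δ ℓ k * m (0, k) =
      ∑ k ∈ Finset.range (ordOf f + 1), orderWeight d e δ ℓ k * m (0, k) := by
    refine (Finset.sum_subset (Finset.range_mono (by omega)) fun k _ hk => ?_).symm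
    rw [hzero k (by simpa using hk), mul_zero]
  rw [hsum]
  rcases le_total ℓ (ordOf f) with h | h
  · have main := hf.sum_orderWeight_mul_le hd0 hd he heδ hdδ hℓ hm
    obtain ⟨r, hr⟩ := Nat.exists_eq_add_of_le h
    nth_rw 2 [show ordOf f + 1 = ℓ + 1 + r by omega] at main
    rw [prod_range_orderWeight, mul_comm, mul_assoc] at main
    refine (Nat.le_of_mul_le_mul_left main (Finset.prod_pos fun k _ => by omega)).trans ?_
    rw [mul_comm]
    refine Nat.mul_le_mul_left _ ?_
    exact Finset.prod_le_prod_of_subset_of_one_le' (Finset.range_mono (by omega))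
      fun i _ _ => by omega
  · have main := hf.sum_orderWeight_mul_le (ℓ := ordOf f) hd0 hd he heδ hdδ
      (fun h0 => hℓ (h0.trans_le h)) hm
    rw [show ordOf f + 1 = ordOf f + 1 + 0 from rfl, prod_range_orderWeight, Finset.prod_range_zero,
      mul_one, mul_comm] at main
    have hw : ∑ k ∈ Finset.range (ordOf f + 1), orderWeight d e δ ℓ k * m (0, k) =
        ∑ k ∈ Finset.range (ordOf f + 1), orderWeight d e δ (ordOf f) k * m (0, k) := by
      refine Finset.sum_congr rfl fun k hk => ?_
      have := Finset.mem_range.1 hk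
      rw [orderWeight, orderWeight, if_pos (by omega), if_pos (by omega)]
    rw [hw]
    refine (Nat.le_of_mul_le_mul_left main (Finset.prod_pos fun k _ => by omega)).trans ?_
    rw [← mul_one (∏ k ∈ Finset.range (ordOf f), _)]
    refine Nat.mul_le_mul ?_ (Finset.one_le_prod' fun i _ => by omega)
    exact Finset.prod_le_prod_of_subset_of_one_le' (Finset.range_mono h) fun i _ _ => by omega

theorem prod_Icc_one_eq_prod_range {M : Type*} [CommMonoid M] (F : ℕ → M) (N : ℕ) :
    ∏ k ∈ Finset.Icc 1 N, F k = ∏ k ∈ Finset.range N, F (k + 1) := by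
  rw [Finset.range_eq_Ico, Finset.prod_Ico_add' F 0 N 1, zero_add]
  rfl

theorem sum_Icc_one_eq_sum_range {M : Type*} [AddCommMonoid M] (F : ℕ → M) (N : ℕ) :
    ∑ k ∈ Finset.Icc 1 N, F k = ∑ k ∈ Finset.range N, F (k + 1) := by
  rw [Finset.range_eq_Ico, Finset.sum_Ico_add' F 0 N 1, zero_add]
  rfl

theorem statement0 (K : Type*) [Field K] [CharZero K] (n : ℕ) [NeZero n]
    (g : Fin n → MvPolynomial (Fin n) K) (d D : ℕ)
    (hd : d = (g 0).totalDegree) (hd0 : 0 < d)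
    (hD : D = (Finset.univ.filter fun i : Fin n => i ≠ 0).sup fun i => (g i).totalDegree)
    (hD0 : 0 < D)
    (f : MvPolynomial (Fin n × ℕ) K) (hf : IsMinPoly K n (sysIdeal K n g) f)
    (ν : ℕ) (hν : 0 < ν) (hord : ordOf f ≤ ν)
    (m : (Fin n × ℕ) →₀ ℕ) (hm : MvPolynomial.coeff m f ≠ 0) :
    (d ≤ D →
      m ((0 : Fin n), 0) + ∑ k ∈ Finset.Icc 1 ν, (d + (k - 1) * (D - 1)) * m ((0 : Fin n), k) ≤
        ∏ k ∈ Finset.Icc 1 ν, (d + (k - 1) * (D - 1))) ∧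
    (D < d → ∀ ℓ < ν,
      (∑ k ∈ Finset.range (ℓ + 1), (k * (D - 1) + 1) * m ((0 : Fin n), k)) +
        (∑ i ∈ Finset.Icc 1 (ν - ℓ), (i * (d - 1) + ℓ * (D - 1) + 1) * m ((0 : Fin n), i + ℓ)) ≤
      (∏ k ∈ Finset.Icc 1 ℓ, (d + (k - 1) * (D - 1))) *
        ∏ i ∈ Finset.Icc 1 (ν - ℓ), (i * (d - 1) + ℓ * (D - 1) + 1)) := by
  have he : ∀ i ≠ 0, (g i).totalDegree ≤ D - 1 + 1 := fun i hi => by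
    rw [Nat.sub_add_cancel hD0, hD]
    exact Finset.le_sup (f := fun i => (g i).totalDegree) (by simpa using hi)
  simp only [prod_Icc_one_eq_prod_range, sum_Icc_one_eq_sum_range, Nat.add_sub_cancel]
  refine ⟨fun h => ?_, fun h ℓ hℓ => ?_⟩
  · have main := hf.sum_orderWeight_mul_le_of_ordOf_le (ℓ := 0) (δ := D - 1) hd0 hd.ge he le_rfl
      (by omega) (fun h => absurd h (lt_irrefl 0)) hm hord ν.zero_le
    rw [Finset.sum_range_succ', add_comm] at main
    simpa [orderWeight] using main
  · have main := hf.sum_orderWeight_mul_le_of_ordOf_le (ℓ := ℓ) (δ := d - 1) hd0 hd.ge he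
      (by omega) (by omega) (fun _ => by omega) hm hord hℓ.le
    have hweight : ∀ i, d + ℓ * (D - 1) + i * (d - 1) = (i + 1) * (d - 1) + ℓ * (D - 1) + 1 := by
      intro i
      rw [add_one_mul]
      omega
    simp only [hweight] at main
    refine Eq.trans_le ?_ main
    rw [show ν + 1 = ℓ + 1 + (ν - ℓ) by omega, Finset.sum_range_add _ (ℓ + 1)]
    congr 1
    · refine Finset.sum_congr rfl fun k hk => ?_
      rw [orderWeight, if_pos (Nat.lt_succ_iff.1 (Finset.mem_range.1 hk))]
    · refine Finset.sum_congr rfl fun i _ => ?_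
      rw [orderWeight, if_neg (by omega), Nat.add_sub_cancel_left, hweight,
        show ℓ + 1 + i = i + 1 + ℓ by omega]
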